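/- Let W be an algebraic Weyl tensor on Euclidean ℝ⁴. Then the Lorentzian Weyl operator Ŵ_L commutes with the Lorentzian Hodge star J (i.e., Ŵ_L ∘ J = J ∘ Ŵ_L) if and only if W(e₁,x,y,e₁) = 0 for all x,y ∈ ℝ⁴. -/

import Mathlib

open scoped BigOperators

/-- Vectors in ℝ⁴. -/
abbrev V4 : Type := Fin 4 → ℝ

/-- ℝ⁶, identified with Λ²ℝ⁴ via the ordered basis
`e₁∧e₂, e₁∧e₃, e₁∧e₄, e₃∧e₄, e₄∧e₂, e₂∧e₃`. -/
abbrev V6 : Type := Fin 6 → ℝ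

/-- Covariant 4-tensors (multilinear maps ℝ⁴×ℝ⁴×ℝ⁴×ℝ⁴ → ℝ). -/
abbrev Tensor4 : Type := MultilinearMap ℝ (fun _ : Fin 4 => V4) ℝ

/-- Evaluation of a 4-tensor on four vectors. -/
def tapp (W : Tensor4) (x y z w : V4) : ℝ := W ![x, y, z, w]

/-- Standard basis of ℝ⁴ (0-indexed: `e 0 = e₁`, …, `e 3 = e₄`). -/
def e (i : Fin 4) : V4 := Pi.single i 1

/-- Standard basis of ℝ⁶ (0-indexed: `u 0 = u₁`, …, `u 5 = u₆`). -/
def u (c : Fin 6) : V6 := Pi.single c 1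

/-- The index pairs of the six coordinate 2-planes
`e₁∧e₂, e₁∧e₃, e₁∧e₄, e₃∧e₄, e₄∧e₂, e₂∧e₃` (0-indexed). -/
def pairs : Fin 6 → Fin 4 × Fin 4 := ![(0,1), (0,2), (0,3), (2,3), (3,1), (1,2)]

/-- The Minkowski inner product `η` on ℝ⁴ (timelike direction `e₁`). -/
def etaR4 (x y : V4) : ℝ := -(x 0 * y 0) + x 1 * y 1 + x 2 * y 2 + x 3 * y 3

/-- The Lorentzian inner product `⟨·,·⟩_L` on ℝ⁶, of signature (−−−+++). -/
def ipL (ξ η : V6) : ℝ :=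
  -(ξ 0 * η 0) - ξ 1 * η 1 - ξ 2 * η 2 + ξ 3 * η 3 + ξ 4 * η 4 + ξ 5 * η 5

/-- The matrix of the Lorentzian Hodge star `J = [[0, I₃],[−I₃, 0]]`. -/
def Jmat : Matrix (Fin 6) (Fin 6) ℝ :=
  !![0,0,0,1,0,0;
     0,0,0,0,1,0;
     0,0,0,0,0,1;
     -1,0,0,0,0,0;
     0,-1,0,0,0,0;
     0,0,-1,0,0,0]

/-- The Lorentzian Hodge star `J` as a linear map on ℝ⁶. -/
def J : V6 →ₗ[ℝ] V6 := Matrix.toLin' Jmat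

/-- The matrix of the Riemannian Hodge star `S = [[0, I₃],[I₃, 0]]`. -/
def Smat : Matrix (Fin 6) (Fin 6) ℝ :=
  !![0,0,0,1,0,0;
     0,0,0,0,1,0;
     0,0,0,0,0,1;
     1,0,0,0,0,0;
     0,1,0,0,0,0;
     0,0,1,0,0,0]

/-- The Riemannian Hodge star `S` as a linear map on ℝ⁶. -/
def S : V6 →ₗ[ℝ] V6 := Matrix.toLin' Smat

/-- `W` is an algebraic Weyl tensor on Euclidean ℝ⁴. -/
def IsWeylE (W : Tensor4) : Prop :=
  (∀ x y z w, tapp W x y z w = - tapp W y x z w) ∧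
  (∀ x y z w, tapp W x y z w = - tapp W x y w z) ∧
  (∀ x y z w, tapp W x y z w = tapp W z w x y) ∧
  (∀ x y z w, tapp W x y z w + tapp W y z x w + tapp W z x y w = 0) ∧
  (∀ x y, ∑ i : Fin 4, tapp W (e i) x y (e i) = 0)

/-- `W` is an algebraic Weyl tensor on Minkowski ℝ⁴ (η-trace-free). -/
def IsWeylM (W : Tensor4) : Prop :=
  (∀ x y z w, tapp W x y z w = - tapp W y x z w) ∧
  (∀ x y z w, tapp W x y z w = - tapp W x y w z) ∧
  (∀ x y z w, tapp W x y z w = tapp W z w x y) ∧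
  (∀ x y z w, tapp W x y z w + tapp W y z x w + tapp W z x y w = 0) ∧
  (∀ x y, -(tapp W (e 0) x y (e 0)) + tapp W (e 1) x y (e 1)
      + tapp W (e 2) x y (e 2) + tapp W (e 3) x y (e 3) = 0)

/-- `WL` is the Lorentzian Weyl operator of `W`:
`⟨WL u_c, u_r⟩_L = W(e_{i(c)}, e_{j(c)}, e_{i(r)}, e_{j(r)})`. -/
def IsLorentzWeylOp (W : Tensor4) (WL : V6 →ₗ[ℝ] V6) : Prop :=
  ∀ c r : Fin 6,
    ipL (WL (u c)) (u r) =
      tapp W (e (pairs c).1) (e (pairs c).2) (e (pairs r).1) (e (pairs r).2)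

/-- `Wg` is the Riemannian Weyl operator of `W`:
`⟨Wg u_c, u_r⟩ = W(e_{i(c)}, e_{j(c)}, e_{i(r)}, e_{j(r)})` w.r.t. the dot product. -/
def IsRiemWeylOp (W : Tensor4) (Wg : V6 →ₗ[ℝ] V6) : Prop :=
  ∀ c r : Fin 6,
    (∑ i : Fin 6, Wg (u c) i * u r i) =
      tapp W (e (pairs c).1) (e (pairs c).2) (e (pairs r).1) (e (pairs r).2)

/-- The sign `⟨u_c, u_c⟩_L`. -/
def sgnL : Fin 6 → ℝ := ![-1, -1, -1, 1, 1, 1]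

/-- The matrix of `W`, seen as a bilinear form on `Λ²ℝ⁴`, in the basis given by `pairs`. -/
def biv (W : Tensor4) (c r : Fin 6) : ℝ :=
  tapp W (e (pairs c).1) (e (pairs c).2) (e (pairs r).1) (e (pairs r).2)

/-- An algebraic Weyl tensor commutes with the Riemannian Hodge star,
which acts on the basis of `Λ²ℝ⁴` by `c ↦ c + 3`. -/
lemma IsWeylE.biv_add_three {W : Tensor4} (hW : IsWeylE W) (c r : Fin 6) :
    biv W (c + 3) (r + 3) = biv W c r := by
  obtain ⟨h1, h2, h3, -, h5⟩ := hW
  generalize hT : (fun i j k l => tapp W (e i) (e j) (e k) (e l)) = T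
  have a1 : ∀ i j k l, T i j k l = - T j i k l := by subst hT; exact fun _ _ _ _ => h1 _ _ _ _
  have a2 : ∀ i j k l, T i j k l = - T i j l k := by subst hT; exact fun _ _ _ _ => h2 _ _ _ _
  have a3 : ∀ i j k l, T i j k l = T k l i j := by subst hT; exact fun _ _ _ _ => h3 _ _ _ _
  have z1 : ∀ i k l, T i i k l = 0 := fun i k l => by linarith [a1 i i k l]
  have z2 : ∀ i j k, T i j k k = 0 := fun i j k => by linarith [a2 i j k k]
  have a5 : ∀ j k, T 0 j k 0 + T 1 j k 1 + T 2 j k 2 + T 3 j k 3 = 0 := fun j k => by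
    have := h5 (e j) (e k)
    rw [Fin.sum_univ_four] at this
    subst hT
    exact this
  have hb : ∀ c r, biv W c r = T (pairs c).1 (pairs c).2 (pairs r).1 (pairs r).2 := by
    subst hT; exact fun _ _ => rfl
  rw [hb, hb]
  clear hb hT h1 h2 h3 h5
  fin_cases c <;> fin_cases r <;> simp [pairs] <;> grind

lemma IsLorentzWeylOp.apply_u {W : Tensor4} {WL : V6 →ₗ[ℝ] V6} (h : IsLorentzWeylOp W WL)
    (c r : Fin 6) : WL (u c) r = sgnL r * biv W c r := by
  rw [biv, ← h c r]
  fin_cases r <;> simp [ipL, u, sgnL]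

lemma J_apply (v : V6) (r : Fin 6) : J v r = - sgnL r * v (r + 3) := by
  fin_cases r <;>
    simp [J, Jmat, sgnL, Matrix.mulVec, dotProduct, Fin.sum_univ_six]

lemma sgnL_add_three (c : Fin 6) : sgnL (c + 3) = - sgnL c := by
  fin_cases c <;> simp [sgnL]

lemma sgnL_mul_self (c : Fin 6) : sgnL c * sgnL c = 1 := by
  fin_cases c <;> simp [sgnL]

lemma J_u (c : Fin 6) : J (u c) = sgnL c • u (c + 3) := by
  ext r
  rw [J_apply]
  fin_cases c <;> fin_cases r <;> simp [u, sgnL]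

lemma add_three_add_three (c : Fin 6) : c + 3 + 3 = c := by
  fin_cases c <;> rfl

/-- The Lorentzian Weyl operator commutes with `J` iff the diagonal blocks of `W` vanish. -/
lemma comp_J_eq_iff {W : Tensor4} {WL : V6 →ₗ[ℝ] V6} (hW : IsWeylE W)
    (hWL : IsLorentzWeylOp W WL) :
    WL.comp J = J.comp WL ↔ ∀ c r, (sgnL c * sgnL r + 1) * biv W c r = 0 := by
  have key (c r : Fin 6) : WL (J (u c)) r - J (WL (u c)) r =
      -((sgnL (c + 3) * sgnL r + 1) * biv W (c + 3) r) := by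
    have hs := hW.biv_add_three c (r + 3)
    rw [add_three_add_three] at hs
    rw [J_u, J_apply, map_smul, Pi.smul_apply, smul_eq_mul, hWL.apply_u, hWL.apply_u,
      sgnL_add_three, sgnL_add_three, ← hs]
    linear_combination -biv W (c + 3) r * sgnL_mul_self r
  constructor
  · intro h c r
    have hk := key (c + 3) r
    rw [add_three_add_three, ← LinearMap.comp_apply, h, LinearMap.comp_apply, sub_self] at hk
    linarith
  · intro h
    refine LinearMap.pi_ext' fun c => LinearMap.ext_ring (funext fun r => ?_)
    have hk := key c r
    rw [h, neg_zero] at hk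
    exact sub_eq_zero.mp hk

lemma update_one {α : Type*} (a x y b z : α) :
    Function.update ![a, x, y, b] 1 z = ![a, z, y, b] := by
  ext i; fin_cases i <;> rfl

lemma update_two {α : Type*} (a x y b z : α) :
    Function.update ![a, x, y, b] 2 z = ![a, x, z, b] := by
  ext i; fin_cases i <;> rfl

lemma sgnL_castAdd (j : Fin 3) : sgnL (j.castAdd 3) = -1 := by
  fin_cases j <;> rfl

lemma pairs_castAdd (j : Fin 3) : pairs (j.castAdd 3) = (0, j.succ) := by
  fin_cases j <;> rfl

/-- A 4-tensor with fixed outer arguments, as a bilinear map in the inner ones. -/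
def innerBilin (W : Tensor4) (a b : V4) : V4 →ₗ[ℝ] V4 →ₗ[ℝ] ℝ :=
  LinearMap.mk₂ ℝ (fun x y => tapp W a x y b)
    (fun x x' y => by
      simpa only [tapp, update_one] using W.map_update_add ![a, 0, y, b] 1 x x')
    (fun t x y => by
      simpa only [tapp, update_one] using W.map_update_smul ![a, 0, y, b] 1 t x)
    (fun x y y' => by
      simpa only [tapp, update_two] using W.map_update_add ![a, x, 0, b] 2 y y')
    (fun t x y => by
      simpa only [tapp, update_two] using W.map_update_smul ![a, x, 0, b] 2 t y)

lemma tapp_inner_eq_zero_iff (W : Tensor4) (a b : V4) :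
    (∀ x y, tapp W a x y b = 0) ↔ ∀ j k, tapp W a (e j) (e k) b = 0 := by
  refine ⟨fun h j k => h _ _, fun h x y => ?_⟩
  have h0 : innerBilin W a b = 0 :=
    LinearMap.pi_ext' fun j => LinearMap.ext_ring <|
      LinearMap.pi_ext' fun k => LinearMap.ext_ring (h j k)
  exact congrArg (fun B => B x y) h0

/-- Proposition `prop:W1`: for an algebraic Weyl tensor `W` on
Euclidean ℝ⁴, the Lorentzian Weyl operator `Ŵ_L` commutes with the Lorentzian
Hodge star `J` iff `W(e₁,·,·,e₁) = 0`. -/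
theorem stmt6 (W : Tensor4) (WL : V6 →ₗ[ℝ] V6)
    (hW : IsWeylE W) (hWL : IsLorentzWeylOp W WL) :
    WL.comp J = J.comp WL ↔ ∀ x y : V4, tapp W (e 0) x y (e 0) = 0 := by
  rw [comp_J_eq_iff hW hWL, tapp_inner_eq_zero_iff]
  have hR := hW.biv_add_three
  obtain ⟨h1, h2, -, -, -⟩ := hW
  constructor
  · intro h j k
    rw [h2, neg_eq_zero]
    have z (x z w : V4) : tapp W x x z w = 0 := by linarith [h1 x x z w]
    have z' (x y z : V4) : tapp W x y z z = 0 := by linarith [h2 x y z z]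
    induction j using Fin.cases with
    | zero => exact z _ _ _
    | succ j =>
      induction k using Fin.cases with
      | zero => exact z' _ _ _
      | succ k =>
        have hjk := h (j.castAdd 3) (k.castAdd 3)
        rw [sgnL_castAdd, sgnL_castAdd, biv, pairs_castAdd, pairs_castAdd] at hjk
        linarith
  · intro h c r
    have h' (j k : Fin 4) : tapp W (e 0) (e j) (e 0) (e k) = 0 := by
      rw [h2, h, neg_zero]
    have hcr := hR c r
    fin_cases c <;> fin_cases r <;> simp [sgnL, biv, pairs, h'] at hcr ⊢ <;> simp [hcr]
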